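/- Let W : ℝ → ℝ be C³ with W'' > 0, let K > 0, and let u be a C³ solution of u_t = √(1+u_x²) W''(u_x) u_{xx} on [0,1]×[0,T] with u(0,t) = u(1,t) = 0. Then there exist m₀ > 0 and continuous nonnegative functions Λ, Γ on [0,T], depending only on u, W and K (not on the discretization), with the following property: for every 0 < m ≤ m₀ and every crystalline discrete solution u^m on an interval I ⊆ [0,T] with auxiliary slopes s_0 = s_2 and s_{N+1} = s_{N−1}, satisfying |s_i| ≤ K for all 1 ≤ i ≤ N, |s_i − s_{i−1}| ≤ m for 1 ≤ i ≤ N+1, the condition that for every 2 ≤ i ≤ N−1 with s_{i−1} ≠ s_{i+1} the slope s_i lies strictly between s_{i−1} and s_{i+1}, the boundary conditions v_1 = v_N = 0, and the evolution law v_i = √(1+s_i²) Δ_i / l_i for 2 ≤ i ≤ N−1, the quantity Υ(t) = (1/2)∫₀¹ |u_x(x,t) − u_x^m(x,t)|² dx satisfies Υ′(t) ≤ Λ(t) Υ(t) + Γ(t) m for all t ∈ I. -/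

import Mathlib

open Set MeasureTheory

/-- A crystalline discrete solution on a time interval `I`. -/
structure CrystSol (I : Set ℝ) where
  /-- number of faces -/
  N : ℕ
  hN : 2 ≤ N
  /-- slopes of the faces -/
  s : ℕ → ℝ
  /-- corner positions -/
  x : ℕ → ℝ → ℝ
  /-- face velocities -/
  v : ℕ → ℝ → ℝ
  /-- the piecewise linear function `u^m` -/
  um : ℝ → ℝ → ℝ
  hs : ∀ i, 1 ≤ i → i + 1 ≤ N → s i ≠ s (i + 1)
  hx0 : ∀ t ∈ I, x 0 t = 0
  hxN : ∀ t ∈ I, x N t = 1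
  hmono : ∀ t ∈ I, ∀ i, i + 1 ≤ N → x i t < x (i + 1) t
  hvC1 : ∀ i, 1 ≤ i → i ≤ N → ContDiffOn ℝ 1 (v i) I
  hcorner : ∀ t ∈ I, ∀ i, 1 ≤ i → i + 1 ≤ N →
    HasDerivWithinAt (x i) (-((v (i + 1) t - v i t) / (s (i + 1) - s i))) I t
  haff : ∀ t ∈ I, ∀ i, 1 ≤ i → i ≤ N → ∀ ξ ∈ Icc (x (i - 1) t) (x i t),
    um ξ t = um (x (i - 1) t) t + s i * (ξ - x (i - 1) t)
  hvel : ∀ t ∈ I, ∀ i, 1 ≤ i → i ≤ N → ∀ ξ ∈ Ioo (x (i - 1) t) (x i t),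
    HasDerivWithinAt (fun τ => um ξ τ) (v i t) I t

/-- The length of the (projection of the) `i`-th face. -/
def CrystSol.len {I : Set ℝ} (S : CrystSol I) (i : ℕ) (t : ℝ) : ℝ :=
  S.x i t - S.x (i - 1) t

/-- The quantity `Δ_i`: the second divided difference of `W` at `s_{i-1}, s_i, s_{i+1}`. -/
noncomputable def secondDD (W : ℝ → ℝ) (s : ℕ → ℝ) (i : ℕ) : ℝ :=
  (W (s (i + 1)) - W (s i)) / (s (i + 1) - s i) -
    (W (s i) - W (s (i - 1))) / (s i - s (i - 1))


/-- A `C³` function `u` on `[0,1] × [0,T]` together with its relevant partial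
derivatives `u_x`, `u_xx`, `u_xxx`, `u_t`, `u_xt`, all continuous. -/
structure C3Sol (T : ℝ) where
  u : ℝ → ℝ → ℝ
  ux : ℝ → ℝ → ℝ
  uxx : ℝ → ℝ → ℝ
  uxxx : ℝ → ℝ → ℝ
  ut : ℝ → ℝ → ℝ
  uxt : ℝ → ℝ → ℝ
  hux : ∀ t ∈ Icc (0:ℝ) T, ∀ ξ ∈ Icc (0:ℝ) 1,
    HasDerivWithinAt (fun a => u a t) (ux ξ t) (Icc 0 1) ξ
  huxx : ∀ t ∈ Icc (0:ℝ) T, ∀ ξ ∈ Icc (0:ℝ) 1,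
    HasDerivWithinAt (fun a => ux a t) (uxx ξ t) (Icc 0 1) ξ
  huxxx : ∀ t ∈ Icc (0:ℝ) T, ∀ ξ ∈ Icc (0:ℝ) 1,
    HasDerivWithinAt (fun a => uxx a t) (uxxx ξ t) (Icc 0 1) ξ
  hut : ∀ ξ ∈ Icc (0:ℝ) 1, ∀ t ∈ Icc (0:ℝ) T,
    HasDerivWithinAt (fun τ => u ξ τ) (ut ξ t) (Icc 0 T) t
  huxt : ∀ ξ ∈ Icc (0:ℝ) 1, ∀ t ∈ Icc (0:ℝ) T,
    HasDerivWithinAt (fun τ => ux ξ τ) (uxt ξ t) (Icc 0 T) t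
  hcont_u : ContinuousOn (fun q : ℝ × ℝ => u q.1 q.2) (Icc 0 1 ×ˢ Icc 0 T)
  hcont_ux : ContinuousOn (fun q : ℝ × ℝ => ux q.1 q.2) (Icc 0 1 ×ˢ Icc 0 T)
  hcont_uxx : ContinuousOn (fun q : ℝ × ℝ => uxx q.1 q.2) (Icc 0 1 ×ˢ Icc 0 T)
  hcont_uxxx : ContinuousOn (fun q : ℝ × ℝ => uxxx q.1 q.2) (Icc 0 1 ×ˢ Icc 0 T)
  hcont_ut : ContinuousOn (fun q : ℝ × ℝ => ut q.1 q.2) (Icc 0 1 ×ˢ Icc 0 T)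
  hcont_uxt : ContinuousOn (fun q : ℝ × ℝ => uxt q.1 q.2) (Icc 0 1 ×ˢ Icc 0 T)

/-- `uxm` is the spatial derivative of the discrete solution: it equals the face slope
`s_i` on the interior of each face. -/
def SlopeLink {I : Set ℝ} (S : CrystSol I) (uxm : ℝ → ℝ → ℝ) : Prop :=
  ∀ t ∈ I, ∀ i, 1 ≤ i → i ≤ S.N →
    ∀ ξ ∈ Set.Ioo (S.x (i - 1) t) (S.x i t), uxm ξ t = S.s i

/-- `utm` is the time derivative of the discrete solution: it equals the face velocity
`v_i` on the interior of each face. -/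
def VelLink {I : Set ℝ} (S : CrystSol I) (utm : ℝ → ℝ → ℝ) : Prop :=
  ∀ t ∈ I, ∀ i, 1 ≤ i → i ≤ S.N →
    ∀ ξ ∈ Set.Ioo (S.x (i - 1) t) (S.x i t), utm ξ t = S.v i t

/-- The discrete solution `S` agrees with the global function `um` on `[0,1]`. -/
def UmLink {I : Set ℝ} (S : CrystSol I) (um : ℝ → ℝ → ℝ) : Prop :=
  ∀ t ∈ I, ∀ ξ ∈ Set.Icc (0:ℝ) 1, S.um ξ t = um ξ t

open Filter Topology

/-- Differentiation under the integral sign on a rectangle, within a closed time interval. -/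
lemma hasDerivWithinAt_integral_of_continuousOn_rect {F F' : ℝ → ℝ → ℝ} {a b T t : ℝ}
    (hab : a ≤ b) (ht : t ∈ Icc 0 T)
    (hF : ∀ σ ∈ Icc 0 T, ContinuousOn (fun ξ => F ξ σ) (Icc a b))
    (hF' : ContinuousOn (fun q : ℝ × ℝ => F' q.1 q.2) (Icc a b ×ˢ Icc 0 T))
    (hd : ∀ ξ ∈ Icc a b, ∀ σ ∈ Icc 0 T,
      HasDerivWithinAt (fun τ => F ξ τ) (F' ξ σ) (Icc 0 T) σ) :
    HasDerivWithinAt (fun σ => ∫ ξ in a..b, F ξ σ) (∫ ξ in a..b, F' ξ t) (Icc 0 T) t := by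
  obtain ⟨C, hC⟩ := (isCompact_Icc.prod isCompact_Icc).exists_bound_of_continuousOn hF'
  have hint : ∀ σ ∈ Icc 0 T, IntervalIntegrable (fun ξ => F ξ σ) volume a b := fun σ hσ =>
    ContinuousOn.intervalIntegrable_of_Icc hab (hF σ hσ)
  have hmem : ∀ᶠ σ in 𝓝[Icc 0 T \ {t}] t, σ ∈ Icc 0 T ∧ σ ≠ t := by
    filter_upwards [self_mem_nhdsWithin] with σ hσ using ⟨hσ.1, by simpa using hσ.2⟩
  have huIoc : Set.uIoc a b ⊆ Icc a b := by
    rw [uIoc_of_le hab]; exact Ioc_subset_Icc_self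
  rw [hasDerivWithinAt_iff_tendsto_slope]
  have key : Tendsto (fun σ => ∫ ξ in a..b, slope (fun τ => F ξ τ) t σ) (𝓝[Icc 0 T \ {t}] t)
      (𝓝 (∫ ξ in a..b, F' ξ t)) := by
    refine intervalIntegral.tendsto_integral_filter_of_dominated_convergence (fun _ => C)
      ?_ ?_ intervalIntegrable_const ?_
    · filter_upwards [hmem] with σ hσ
      simp only [slope_def_field]
      exact (((hint σ hσ.1).sub (hint t ht)).div_const _).aestronglyMeasurable_restrict_uIoc
    · filter_upwards [hmem] with σ hσ
      refine Eventually.of_forall fun ξ hξ => ?_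
      have hξ' := huIoc hξ
      have := (convex_Icc (0:ℝ) T).norm_image_sub_le_of_norm_hasDerivWithin_le
        (f := fun τ => F ξ τ) (hd ξ hξ') (fun σ hσ => hC (ξ, σ) ⟨hξ', hσ⟩) ht hσ.1
      rw [slope_def_field, norm_div]
      exact div_le_of_le_mul₀ (norm_nonneg _)
        ((norm_nonneg _).trans (hC (ξ, t) ⟨hξ', ht⟩)) this
    · refine Eventually.of_forall fun ξ hξ => ?_
      exact hasDerivWithinAt_iff_tendsto_slope.1 (hd ξ (huIoc hξ) t ht)
  refine key.congr' ?_
  filter_upwards [hmem] with σ hσ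
  simp only [slope_def_field]
  rw [intervalIntegral.integral_div, intervalIntegral.integral_sub (hint σ hσ.1) (hint t ht)]

/-- Chain rule for `σ ↦ f (x σ) σ` when the first partial derivative is continuous. -/
lemma hasDerivWithinAt_comp_curve {f fx : ℝ → ℝ → ℝ} {x : ℝ → ℝ} {I J : Set ℝ} {a b t c ft : ℝ}
    (hIJ : I ⊆ J) (ht : t ∈ I)
    (hfx : ∀ σ ∈ J, ∀ ξ ∈ Icc a b, HasDerivWithinAt (fun ξ => f ξ σ) (fx ξ σ) (Icc a b) ξ)
    (hcont : ContinuousOn (fun q : ℝ × ℝ => fx q.1 q.2) (Icc a b ×ˢ J))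
    (hft : HasDerivWithinAt (fun τ => f (x t) τ) ft I t)
    (hmem : ∀ σ ∈ I, x σ ∈ Icc a b) (hx : HasDerivWithinAt x c I t) :
    HasDerivWithinAt (fun σ => f (x σ) σ) (fx (x t) t * c + ft) I t := by
  have hxt : Tendsto x (𝓝[I] t) (𝓝 (x t)) := hx.continuousWithinAt
  have hI : ∀ᶠ σ in 𝓝[I] t, σ ∈ I := self_mem_nhdsWithin
  have h1 : (fun σ => f (x σ) σ - f (x t) σ - fx (x t) t * (x σ - x t)) =o[𝓝[I] t]
      (fun σ => x σ - x t) := by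
    rw [Asymptotics.isLittleO_iff]
    intro ε hε
    obtain ⟨δ, hδ, hδc⟩ := Metric.continuousWithinAt_iff.1 (hcont (x t, t) ⟨hmem t ht, hIJ ht⟩) ε hε
    filter_upwards [hI, hxt (Metric.ball_mem_nhds _ hδ),
      mem_nhdsWithin_of_mem_nhds (Metric.ball_mem_nhds t hδ)] with σ hσ hxσ hσt
    have hsub : uIcc (x t) (x σ) ⊆ Icc a b := by
      rw [← segment_eq_uIcc]
      exact (convex_Icc a b).segment_subset (hmem t ht) (hmem σ hσ)
    have := (convex_uIcc (x t) (x σ)).norm_image_sub_le_of_norm_hasDerivWithin_le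
      (f := fun ξ => f ξ σ - fx (x t) t * ξ) (f' := fun ξ => fx ξ σ - fx (x t) t) (C := ε)
      (fun ξ hξ => ((hfx σ (hIJ hσ) ξ (hsub hξ)).mono hsub).sub
        ((hasDerivWithinAt_id ξ _).const_mul _ |>.congr_deriv (mul_one _)))
      (fun ξ hξ => ?_) left_mem_uIcc right_mem_uIcc
    · refine le_trans (le_of_eq ?_) this
      congr 1
      ring
    · refine (hδc (x := (ξ, σ)) ⟨hsub hξ, hIJ hσ⟩ ?_).le
      rw [Prod.dist_eq]
      refine max_lt (lt_of_le_of_lt ?_ hxσ) hσt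
      rw [Real.dist_eq, Real.dist_eq]
      exact abs_sub_left_of_mem_uIcc hξ
  have h4 : HasDerivWithinAt (fun σ => f (x σ) σ - f (x t) σ) (fx (x t) t * c) I t := by
    rw [hasDerivWithinAt_iff_isLittleO]
    have h5 := h1.trans_isBigO
      (hx.isBigO_sub.comp_tendsto (tendsto_id.prodMk tendsto_const_pure))
    have h6 := ((hasDerivWithinAt_iff_isLittleO.1 hx).const_mul_left (fx (x t) t)).add h5
    refine h6.congr_left fun σ => ?_
    simp
    ring
  have := h4.add hft
  refine this.congr_of_eventuallyEq ?_ ?_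
  · exact Eventually.of_forall fun σ => by simp
  · simp

/-- Second divided differences are values of half the second derivative, rescaled. -/
lemma exists_divided_difference_eq {W W' W'' : ℝ → ℝ} (h1 : ∀ y, HasDerivAt W (W' y) y)
    (h2 : ∀ y, HasDerivAt W' (W'' y) y) {C : Set ℝ} (hC : Convex ℝ C) {y p q : ℝ}
    (hy : y ∈ C) (hp : p ∈ C) (hq : q ∈ C) (hyp : y ≠ p) (hqy : q ≠ y) :
    ∃ θ ∈ C, (W q - W y) / (q - y) - (W y - W p) / (y - p) = W'' θ * ((q - p) / 2) := by
  have hp0 : p - y ≠ 0 := sub_ne_zero.2 hyp.symm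
  have hp1 : y - p ≠ 0 := sub_ne_zero.2 hyp
  have hq0 : q - y ≠ 0 := sub_ne_zero.2 hqy
  have hder : ∀ z τ : ℝ, z - y ≠ 0 → HasDerivAt (fun τ => (W (y + τ * (z - y)) - W y) / (z - y))
      (W' (y + τ * (z - y))) τ := by
    intro z τ hz
    have := ((h1 (y + τ * (z - y))).comp τ
      (((hasDerivAt_id τ).mul_const (z - y)).const_add y)).sub_const (W y) |>.div_const (z - y)
    refine this.congr_deriv ?_
    field_simp
  have hg : ∀ τ : ℝ, HasDerivAt (fun τ : ℝ => τ ^ 2 / 2) τ τ := by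
    intro τ
    refine ((hasDerivAt_pow 2 τ).div_const 2).congr_deriv ?_
    simp
  have hf : ∀ τ, HasDerivAt (fun τ => (W (y + τ * (q - y)) - W y) / (q - y) -
      (W (y + τ * (p - y)) - W y) / (p - y)) (W' (y + τ * (q - y)) - W' (y + τ * (p - y))) τ :=
    fun τ => (hder q τ hq0).sub (hder p τ hp0)
  obtain ⟨τ, hτ, hτeq⟩ := exists_ratio_hasDerivAt_eq_ratio_slope _ _ zero_lt_one
    (fun τ _ => (hf τ).continuousAt.continuousWithinAt) (fun τ _ => hf τ) _ _
    (fun τ _ => (hg τ).continuousAt.continuousWithinAt) (fun τ _ => hg τ)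
  have hmem : ∀ z ∈ C, y + τ * (z - y) ∈ C := fun z hz =>
    hC.add_smul_sub_mem hy hz ⟨hτ.1.le, hτ.2.le⟩
  obtain ⟨θ, hθ, hθeq⟩ : ∃ θ ∈ C, W' (y + τ * (q - y)) - W' (y + τ * (p - y)) =
      W'' θ * ((y + τ * (q - y)) - (y + τ * (p - y))) := by
    have mvt : ∀ a ∈ C, ∀ b ∈ C, a < b → ∃ θ ∈ C, W' b - W' a = W'' θ * (b - a) := by
      intro a ha b hb hab
      obtain ⟨θ, hθ, h⟩ := exists_hasDerivAt_eq_slope W' W'' hab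
        (fun z _ => (h2 z).continuousAt.continuousWithinAt) (fun z _ => h2 z)
      refine ⟨θ, hC.ordConnected.out ha hb ⟨hθ.1.le, hθ.2.le⟩, ?_⟩
      rw [h, div_mul_cancel₀ _ (sub_ne_zero.2 hab.ne')]
    rcases lt_trichotomy (y + τ * (p - y)) (y + τ * (q - y)) with h | h | h
    · exact mvt _ (hmem p hp) _ (hmem q hq) h
    · exact ⟨y, hy, by simp [h]⟩
    · obtain ⟨θ, hθ, h'⟩ := mvt _ (hmem q hq) _ (hmem p hp) h
      exact ⟨θ, hθ, by linarith⟩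
  refine ⟨θ, hθ, ?_⟩
  have e : (W q - W y) / (q - y) - (W y - W p) / (y - p) =
      (W (y + 1 * (q - y)) - W y) / (q - y) - (W (y + 1 * (p - y)) - W y) / (p - y) := by
    rw [one_mul, one_mul, add_sub_cancel, add_sub_cancel, ← neg_sub (W p), ← neg_sub p, neg_div_neg_eq]
  rw [e]
  rw [hθeq] at hτeq
  have hτ0 : τ ≠ 0 := hτ.1.ne'
  simp only [zero_mul, add_zero, sub_self, zero_div, sub_zero] at hτeq
  apply mul_right_cancel₀ hτ0
  rw [← hτeq]
  ring

/-- Fundamental theorem of calculus for a one-sided derivative, on a subinterval. -/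
lemma integral_eq_sub_of_hasDerivWithinAt_Icc {f f' : ℝ → ℝ} {a b p q : ℝ} (hpq : p ≤ q)
    (hsub : Icc p q ⊆ Icc a b) (hd : ∀ ξ ∈ Icc a b, HasDerivWithinAt f (f' ξ) (Icc a b) ξ)
    (hc : ContinuousOn f' (Icc a b)) : ∫ ξ in p..q, f' ξ = f q - f p := by
  refine intervalIntegral.integral_eq_sub_of_hasDerivAt_of_le hpq
    (fun ξ hξ => (hd ξ (hsub hξ)).continuousWithinAt.mono hsub) (fun ξ hξ => ?_)
    ((hc.mono hsub).intervalIntegrable_of_Icc hpq)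
  exact ((hd ξ (hsub (Ioo_subset_Icc_self hξ))).mono hsub).hasDerivAt (Icc_mem_nhds hξ.1 hξ.2)

/-- The defect of a single face is controlled by the slope error on that face. -/
lemma face_defect_le {p f g : ℝ → ℝ} {a b s α β v A a₀ B F L C m : ℝ} (hab : a < b)
    (hp : ContinuousOn p (Icc a b)) (hf : ContinuousOn f (Icc a b))
    (hg : ContinuousOn g (Icc a b))
    (hga : ∀ ξ ∈ Icc a b, |g a - g ξ| ≤ B * (b - a))
    (hgb : ∀ ξ ∈ Icc a b, |g b - g ξ| ≤ B * (b - a))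
    (hB : 0 ≤ B) (hα : |α| ≤ m) (hβ : |β| ≤ m) (hm : 0 ≤ m) (hm1 : m ≤ 1)
    (hE : ∀ ξ ∈ Icc a b, |g ξ - A * f ξ| ≤ (L * |p ξ - s| + C * m) * F)
    (ha₀ : 0 < a₀) (hA : a₀ ≤ A) (hv : v = A * ((α + β) / 2) / (b - a)) :
    -(∫ ξ in a..b, f ξ * g ξ) + ((g a * α + g b * β) / 2 + v * ((∫ ξ in a..b, f ξ) - (α + β) / 2))
      ≤ ∫ ξ in a..b, (F ^ 2 * L ^ 2 / (2 * a₀) * (p ξ - s) ^ 2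
          + (B + F ^ 2 * C ^ 2 / (2 * a₀)) * m) := by
  have hl : 0 < b - a := sub_pos.2 hab
  set q := (α + β) / 2 / (b - a) with hq
  set e := (g a * α + g b * β) / 2 / (b - a) with he
  have hvq : v = A * q := by rw [hv, hq]; ring
  have hi : ∀ {h : ℝ → ℝ}, ContinuousOn h (Icc a b) → IntervalIntegrable h volume a b :=
    fun h => h.intervalIntegrable_of_Icc hab.le
  have hlhs : -(∫ ξ in a..b, f ξ * g ξ) +
      ((g a * α + g b * β) / 2 + v * ((∫ ξ in a..b, f ξ) - (α + β) / 2)) =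
      ∫ ξ in a..b, (-(f ξ * g ξ) + A * q * f ξ + (e - A * q ^ 2)) := by
    have hfg : IntervalIntegrable (fun ξ => -(f ξ * g ξ)) volume a b := (hi (hf.mul hg)).neg
    have hqf : IntervalIntegrable (fun ξ => A * q * f ξ) volume a b := (hi hf).const_mul _
    rw [intervalIntegral.integral_add (hfg.add hqf) intervalIntegrable_const,
      intervalIntegral.integral_add hfg hqf,
      intervalIntegral.integral_neg, intervalIntegral.integral_const_mul,
      intervalIntegral.integral_const, smul_eq_mul]
    have e1 : (g a * α + g b * β) / 2 = (b - a) * e := by rw [he]; field_simp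
    have e2 : (α + β) / 2 = (b - a) * q := by rw [hq]; field_simp
    rw [e1, e2, hvq]
    ring
  rw [hlhs]
  refine intervalIntegral.integral_mono_on hab.le
    (hi (((hf.mul hg).neg.add (hf.const_smul (A * q))).add continuousOn_const))
    (hi (((hp.sub continuousOn_const).pow 2).const_smul (F ^ 2 * L ^ 2 / (2 * a₀)) |>.add
      continuousOn_const)) (fun ξ hξ => ?_)
  have h1 : e ≤ g ξ * q + B * m := by
    have h2 : (g a - g ξ) * α ≤ B * (b - a) * m :=
      (le_abs_self _).trans (by rw [abs_mul]; gcongr; exact hga ξ hξ)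
    have h3 : (g b - g ξ) * β ≤ B * (b - a) * m :=
      (le_abs_self _).trans (by rw [abs_mul]; gcongr; exact hgb ξ hξ)
    have e1 : g ξ * q + B * m = (g ξ * (α + β) / 2 + B * m * (b - a)) / (b - a) := by
      rw [hq]; field_simp
    rw [e1, he]
    gcongr
    linarith
  set E := g ξ - A * f ξ with hEdef
  set r := f ξ - q with hr
  have h4 : E ^ 2 ≤ 2 * F ^ 2 * (L ^ 2 * (p ξ - s) ^ 2 + C ^ 2 * m) := by
    have h5 : E ^ 2 ≤ ((L * |p ξ - s| + C * m) * F) ^ 2 := by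
      rw [← sq_abs]
      exact pow_le_pow_left₀ (abs_nonneg _) (hE ξ hξ) 2
    have h6 : (L * |p ξ - s| + C * m) ^ 2 ≤ 2 * (L ^ 2 * (p ξ - s) ^ 2 + C ^ 2 * m) := by
      have h7 : C ^ 2 * m ^ 2 ≤ C ^ 2 * m := by
        gcongr
        nlinarith
      rw [← sq_abs (p ξ - s)]
      nlinarith [sq_nonneg (L * |p ξ - s| - C * m)]
    rw [mul_pow] at h5
    nlinarith [sq_nonneg F]
  have h8 : -(r * (E + A * r)) ≤ E ^ 2 / (4 * a₀) := by
    rw [le_div_iff₀ (by positivity)]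
    nlinarith [sq_nonneg (E + 2 * a₀ * r), mul_nonneg (mul_nonneg ha₀.le (sub_nonneg.2 hA)) (sq_nonneg r)]
  have h9 : E ^ 2 / (4 * a₀) ≤
      F ^ 2 * L ^ 2 / (2 * a₀) * (p ξ - s) ^ 2 + F ^ 2 * C ^ 2 / (2 * a₀) * m := by
    have e1 : F ^ 2 * L ^ 2 / (2 * a₀) * (p ξ - s) ^ 2 + F ^ 2 * C ^ 2 / (2 * a₀) * m =
        2 * F ^ 2 * (L ^ 2 * (p ξ - s) ^ 2 + C ^ 2 * m) / (4 * a₀) := by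
      field_simp
      ring
    rw [e1]
    gcongr
  have h10 : -(f ξ * g ξ) + A * q * f ξ + (g ξ * q - A * q ^ 2) = -(r * (E + A * r)) := by
    rw [hEdef, hr]; ring
  linarith

/-- Summation by parts over the corners of a crystalline solution. -/
lemma sum_corner_terms_eq {N : ℕ} {s c U g v : ℕ → ℝ} (hc0 : c 0 = 0) (hcN : c N = 0)
    (hg0 : g 0 = 0) (hgN : g N = 0) (hv0 : v 0 + v 1 = 0) (hvN : v N + v (N + 1) = 0)
    (hcv : ∀ k ≤ N, c k * (s (k + 1) - s k) = -(v (k + 1) - v k)) :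
    ∑ k ∈ Finset.range N, (-(s (k + 1) * ((U (k + 1) * c (k + 1) + g (k + 1)) - (U k * c k + g k)))
        + 1 / 2 * (s (k + 1) ^ 2 * (c (k + 1) - c k))) =
      ∑ k ∈ Finset.range N, ((g k * (s (k + 1) - s k) + g (k + 1) * (s (k + 2) - s (k + 1))) / 2 +
        v (k + 1) * (U (k + 1) - U k - ((s (k + 1) - s k) + (s (k + 2) - s (k + 1))) / 2)) := by
  rw [← sub_eq_zero, ← Finset.sum_sub_distrib]
  let P : ℕ → ℝ := fun k => -(1 / 2) * (s k + s (k + 1)) * (U k * c k + g k)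
    + 1 / 4 * (s k ^ 2 + s (k + 1) ^ 2) * c k
    - 1 / 2 * (U k - (s k + s (k + 1)) / 2) * (v k + v (k + 1))
  have hP : P N - P 0 = 0 := by
    simp only [P, hc0, hcN, hg0, hgN, hv0, hvN, zero_add]
    ring
  rw [← hP, ← Finset.sum_range_sub]
  refine Finset.sum_congr rfl fun k hk => ?_
  have hk' := Finset.mem_range.1 hk
  have h1 := hcv k hk'.le
  have h2 := hcv (k + 1) hk'
  simp only [P]
  linear_combination (1 / 2 * U k - 1 / 4 * (s (k + 1) + s k)) * h1 +
    (1 / 2 * U (k + 1) - 1 / 4 * (s (k + 2) + s (k + 1))) * h2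

namespace C3Sol

variable {T : ℝ} (H : C3Sol T)

/-- Mixed partial derivatives commute: `u_t` is a spatial antiderivative of `u_xt`. -/
lemma integral_uxt (hT : 0 < T) {a b t : ℝ} (ha : 0 ≤ a) (hab : a ≤ b) (hb : b ≤ 1)
    (ht : t ∈ Icc 0 T) : ∫ ξ in a..b, H.uxt ξ t = H.ut b t - H.ut a t := by
  have hsub : Icc a b ⊆ Icc 0 1 := Icc_subset_Icc ha hb
  have hslice : ∀ σ ∈ Icc 0 T, ContinuousOn (fun ξ => H.ux ξ σ) (Icc 0 1) := fun σ hσ ξ hξ =>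
    (H.huxx σ hσ ξ hξ).continuousWithinAt
  have h1 := hasDerivWithinAt_integral_of_continuousOn_rect (F := H.ux) (F' := H.uxt) hab ht
    (fun σ hσ => (hslice σ hσ).mono hsub)
    (H.hcont_uxt.mono (prod_mono hsub Subset.rfl))
    (fun ξ hξ σ hσ => H.huxt ξ (hsub hξ) σ hσ)
  have h2 := (H.hut b (hsub ⟨hab, le_rfl⟩) t ht).sub (H.hut a (hsub ⟨le_rfl, hab⟩) t ht)
  have h3 : ∀ σ ∈ Icc 0 T, ∫ ξ in a..b, H.ux ξ σ = H.u b σ - H.u a σ := fun σ hσ =>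
    integral_eq_sub_of_hasDerivWithinAt_Icc hab hsub (H.hux σ hσ) (hslice σ hσ)
  exact (uniqueDiffOn_Icc hT t ht).eq_deriv _ h1 (h2.congr h3 (h3 t ht))

lemma continuousOn_slice {f : ℝ → ℝ → ℝ} {t : ℝ}
    (hf : ContinuousOn (fun q : ℝ × ℝ => f q.1 q.2) (Icc 0 1 ×ˢ Icc 0 T)) (ht : t ∈ Icc 0 T) :
    ContinuousOn (fun ξ => f ξ t) (Icc 0 1) :=
  hf.comp (f := fun ξ : ℝ => (ξ, t)) (by fun_prop) fun _ hξ => ⟨hξ, ht⟩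

/-- Under homogeneous Dirichlet conditions the velocity vanishes at both ends. -/
lemma ut_eq_zero (hT : 0 < T) {a t : ℝ} (ha : a ∈ Icc (0 : ℝ) 1) (hbc : ∀ σ ∈ Icc 0 T, H.u a σ = 0)
    (ht : t ∈ Icc 0 T) : H.ut a t = 0 :=
  (uniqueDiffOn_Icc hT t ht).eq_deriv _ (H.hut a ha t ht)
    ((hasDerivWithinAt_const t _ (0 : ℝ)).congr hbc (hbc t ht))

/-- Integration by parts of `u_x u_xt` when the velocity vanishes at both ends. -/
lemma integral_ux_mul_uxt (hT : 0 < T) {t : ℝ} (ht : t ∈ Icc 0 T) (h0 : H.ut 0 t = 0)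
    (h1 : H.ut 1 t = 0) :
    ∫ ξ in (0 : ℝ)..1, H.ux ξ t * H.uxt ξ t = -∫ ξ in (0 : ℝ)..1, H.uxx ξ t * H.ut ξ t := by
  have cx := continuousOn_slice H.hcont_ux ht
  have cxx := continuousOn_slice H.hcont_uxx ht
  have ct := continuousOn_slice H.hcont_ut ht
  have cxt := continuousOn_slice H.hcont_uxt ht
  have hi : ∀ {h : ℝ → ℝ}, ContinuousOn h (Icc 0 1) → IntervalIntegrable h volume 0 1 :=
    fun h => h.intervalIntegrable_of_Icc zero_le_one
  have hd : ∀ ξ ∈ Ioo (0 : ℝ) 1, HasDerivAt (fun ξ => H.ut ξ t) (H.uxt ξ t) ξ := by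
    intro ξ hξ
    have hnhds := Icc_mem_nhds hξ.1 hξ.2
    have hft : HasDerivAt (fun y => ∫ z in (0 : ℝ)..y, H.uxt z t) (H.uxt ξ t) ξ :=
      intervalIntegral.integral_hasDerivAt_right
        ((cxt.mono (Icc_subset_Icc_right hξ.2.le)).intervalIntegrable_of_Icc hξ.1.le)
        ((cxt.mono Ioo_subset_Icc_self).stronglyMeasurableAtFilter isOpen_Ioo ξ hξ)
        (cxt.continuousAt hnhds)
    refine hft.congr_of_eventuallyEq ?_
    filter_upwards [hnhds] with y hy
    rw [H.integral_uxt hT le_rfl hy.1 hy.2 ht, h0, sub_zero]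
  have hsum : ∫ ξ in (0 : ℝ)..1, (H.uxx ξ t * H.ut ξ t + H.ux ξ t * H.uxt ξ t) = 0 := by
    rw [intervalIntegral.integral_eq_sub_of_hasDerivAt_of_le zero_le_one (cx.mul ct)
      (fun ξ hξ => ((H.huxx t ht ξ (Ioo_subset_Icc_self hξ)).hasDerivAt
        (Icc_mem_nhds hξ.1 hξ.2)).mul (hd ξ hξ))
      (hi ((cxx.mul ct).add (cx.mul cxt)))]
    simp [h0, h1]
  have i1 : IntervalIntegrable (fun ξ => H.uxx ξ t * H.ut ξ t) volume 0 1 := hi (cxx.mul ct)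
  have i2 : IntervalIntegrable (fun ξ => H.ux ξ t * H.uxt ξ t) volume 0 1 := hi (cx.mul cxt)
  rw [intervalIntegral.integral_add i1 i2] at hsum
  linarith

end C3Sol

namespace CrystSol

variable {I : Set ℝ} (S : CrystSol I)

lemma x_le_x {t : ℝ} (ht : t ∈ I) {i j : ℕ} (hij : i ≤ j) (hj : j ≤ S.N) : S.x i t ≤ S.x j t := by
  induction j, hij using Nat.le_induction with
  | base => exact le_rfl
  | succ j _ ih => exact (ih (by omega)).trans (S.hmono t ht j hj).le

lemma x_mem_Icc {t : ℝ} (ht : t ∈ I) {i : ℕ} (hi : i ≤ S.N) : S.x i t ∈ Icc (0 : ℝ) 1 :=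
  ⟨S.hx0 t ht ▸ S.x_le_x ht (Nat.zero_le i) hi, S.hxN t ht ▸ S.x_le_x ht hi le_rfl⟩

lemma face_subset {t : ℝ} (ht : t ∈ I) {k : ℕ} (hk : k < S.N) :
    Icc (S.x k t) (S.x (k + 1) t) ⊆ Icc 0 1 :=
  Icc_subset_Icc (S.x_mem_Icc ht hk.le).1 (S.x_mem_Icc ht hk).2

/-- An integral over `[0,1]` is the sum of the integrals over the faces. -/
lemma integral_eq_sum {t : ℝ} (ht : t ∈ I) {h : ℝ → ℝ}
    (hh : ∀ k < S.N, IntervalIntegrable h volume (S.x k t) (S.x (k + 1) t)) :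
    ∫ ξ in (0 : ℝ)..1, h ξ =
      ∑ k ∈ Finset.range S.N, ∫ ξ in (S.x k t)..(S.x (k + 1) t), h ξ := by
  rw [intervalIntegral.sum_integral_adjacent_intervals (a := fun k => S.x k t) hh, S.hx0 t ht,
    S.hxN t ht]

lemma integral_eq_sum_of_continuousOn {t : ℝ} (ht : t ∈ I) {h : ℝ → ℝ}
    (hh : ContinuousOn h (Icc 0 1)) :
    ∫ ξ in (0 : ℝ)..1, h ξ =
      ∑ k ∈ Finset.range S.N, ∫ ξ in (S.x k t)..(S.x (k + 1) t), h ξ :=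
  S.integral_eq_sum ht fun k hk =>
    (hh.mono (S.face_subset ht hk)).intervalIntegrable_of_Icc (S.hmono t ht k hk).le

/-- The squared slope error, face by face. -/
lemma integral_sq_sub_slope {uxm : ℝ → ℝ → ℝ} (hlink : SlopeLink S uxm) {t : ℝ} (ht : t ∈ I)
    {p : ℝ → ℝ} (hp : ContinuousOn p (Icc 0 1)) :
    ∫ ξ in (0 : ℝ)..1, (p ξ - uxm ξ t) ^ 2 =
      ∑ k ∈ Finset.range S.N, ∫ ξ in (S.x k t)..(S.x (k + 1) t), (p ξ - S.s (k + 1)) ^ 2 := by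
  have heq : ∀ k < S.N, EqOn (fun ξ => (p ξ - S.s (k + 1)) ^ 2) (fun ξ => (p ξ - uxm ξ t) ^ 2)
      (uIoo (S.x k t) (S.x (k + 1) t)) := by
    intro k hk ξ hξ
    rw [uIoo_of_le (S.hmono t ht k hk).le] at hξ
    simp only [hlink t ht (k + 1) (by omega) hk ξ hξ]
  rw [S.integral_eq_sum ht fun k hk => (ContinuousOn.intervalIntegrable_of_Icc
    (S.hmono t ht k hk).le (((hp.mono (S.face_subset ht hk)).sub continuousOn_const).pow
      2)).congr_uIoo (heq k hk)]
  exact Finset.sum_congr rfl fun k hk =>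
    (intervalIntegral.integral_congr_uIoo (heq k (Finset.mem_range.1 hk))).symm

/-- Expansion of the squared slope error in terms of `u_x`, the corners and `u` at the corners. -/
lemma integral_sq_sub_slope_eq {T : ℝ} (H : C3Sol T) (hI : I ⊆ Icc 0 T) {uxm : ℝ → ℝ → ℝ}
    (hlink : SlopeLink S uxm) {t : ℝ} (ht : t ∈ I) :
    1 / 2 * ∫ ξ in (0 : ℝ)..1, (H.ux ξ t - uxm ξ t) ^ 2 =
      (∫ ξ in (0 : ℝ)..1, 1 / 2 * H.ux ξ t ^ 2) + ∑ k ∈ Finset.range S.N,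
        (-(S.s (k + 1) * (H.u (S.x (k + 1) t) t - H.u (S.x k t) t)) +
          1 / 2 * (S.s (k + 1) ^ 2 * (S.x (k + 1) t - S.x k t))) := by
  have hc := C3Sol.continuousOn_slice H.hcont_ux (hI ht)
  rw [S.integral_sq_sub_slope hlink ht hc,
    S.integral_eq_sum_of_continuousOn ht (h := fun ξ => 1 / 2 * H.ux ξ t ^ 2)
      (continuousOn_const.mul (hc.pow 2)),
    ← Finset.sum_add_distrib, Finset.mul_sum]
  refine Finset.sum_congr rfl fun k hk => ?_
  have hk' := Finset.mem_range.1 hk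
  have hle := (S.hmono t ht k hk').le
  have hsub := S.face_subset ht hk'
  have hi : ∀ {h : ℝ → ℝ}, ContinuousOn h (Icc 0 1) →
      IntervalIntegrable h volume (S.x k t) (S.x (k + 1) t) :=
    fun h => (h.mono hsub).intervalIntegrable_of_Icc hle
  rw [← integral_eq_sub_of_hasDerivWithinAt_Icc hle hsub (H.hux t (hI ht)) hc,
    ← intervalIntegral.integral_const_mul, ← intervalIntegral.integral_const_mul]
  have e : ∀ ξ, 1 / 2 * (H.ux ξ t - S.s (k + 1)) ^ 2 = 1 / 2 * H.ux ξ t ^ 2 -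
      S.s (k + 1) * H.ux ξ t + 1 / 2 * S.s (k + 1) ^ 2 := fun ξ => by ring
  have i1 : IntervalIntegrable (fun ξ => 1 / 2 * H.ux ξ t ^ 2) volume (S.x k t) (S.x (k + 1) t) :=
    hi (continuousOn_const.mul (hc.pow 2))
  have i2 : IntervalIntegrable (fun ξ => S.s (k + 1) * H.ux ξ t) volume (S.x k t)
      (S.x (k + 1) t) := hi (continuousOn_const.mul hc)
  simp only [e]
  rw [intervalIntegral.integral_add (i1.sub i2) intervalIntegrable_const,
    intervalIntegral.integral_sub i1 i2, intervalIntegral.integral_const, smul_eq_mul]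
  ring

/-- Time derivative of the squared slope error, in terms of the corner velocities `c`. -/
lemma hasDerivWithinAt_slopeError {T : ℝ} (H : C3Sol T) (hI : I ⊆ Icc 0 T) {uxm : ℝ → ℝ → ℝ}
    (hlink : SlopeLink S uxm) {t : ℝ} (ht : t ∈ I) {c : ℕ → ℝ}
    (hc : ∀ k ≤ S.N, HasDerivWithinAt (S.x k) (c k) I t) :
    HasDerivWithinAt (fun σ => 1 / 2 * ∫ ξ in (0 : ℝ)..1, (H.ux ξ σ - uxm ξ σ) ^ 2)
      ((∫ ξ in (0 : ℝ)..1, H.ux ξ t * H.uxt ξ t) + ∑ k ∈ Finset.range S.N,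
        (-(S.s (k + 1) * ((H.ux (S.x (k + 1) t) t * c (k + 1) + H.ut (S.x (k + 1) t) t) -
            (H.ux (S.x k t) t * c k + H.ut (S.x k t) t))) +
          1 / 2 * (S.s (k + 1) ^ 2 * (c (k + 1) - c k)))) I t := by
  have hu : ∀ k ≤ S.N, HasDerivWithinAt (fun σ => H.u (S.x k σ) σ)
      (H.ux (S.x k t) t * c k + H.ut (S.x k t) t) I t := fun k hk =>
    hasDerivWithinAt_comp_curve hI ht H.hux H.hcont_ux
      ((H.hut _ (S.x_mem_Icc ht hk) t (hI ht)).mono hI)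
      (fun σ hσ => S.x_mem_Icc hσ hk) (hc k hk)
  have hsq : HasDerivWithinAt (fun σ => ∫ ξ in (0 : ℝ)..1, 1 / 2 * H.ux ξ σ ^ 2)
      (∫ ξ in (0 : ℝ)..1, H.ux ξ t * H.uxt ξ t) (Icc 0 T) t :=
    hasDerivWithinAt_integral_of_continuousOn_rect (F := fun ξ σ => 1 / 2 * H.ux ξ σ ^ 2)
      (F' := fun ξ σ => H.ux ξ σ * H.uxt ξ σ) zero_le_one (hI ht)
      (fun σ hσ => continuousOn_const.mul ((C3Sol.continuousOn_slice H.hcont_ux hσ).pow 2))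
      (H.hcont_ux.mul H.hcont_uxt)
      (fun ξ hξ σ hσ => (((H.huxt ξ hξ σ hσ).pow 2).const_mul (1 / 2)).congr_deriv (by
        simp only [Nat.cast_ofNat, Nat.add_one_sub_one, pow_one]; ring))
  refine ((hsq.mono hI).add (HasDerivWithinAt.fun_sum fun k hk => ?_)).congr
    (fun σ hσ => S.integral_sq_sub_slope_eq H hI hlink hσ)
    (S.integral_sq_sub_slope_eq H hI hlink ht)
  have hk' := Finset.mem_range.1 hk
  exact (((hu (k + 1) hk').sub (hu k hk'.le)).const_mul _).neg.add
    ((((hc (k + 1) hk').sub (hc k hk'.le)).const_mul _).const_mul _)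

end CrystSol

/-- The face velocities have the form `√(1+s_i²) W''(θ) D_i / l_i` with `D_i` half the slope
increment across the face and `θ` close to `s_i`; on the two boundary faces both sides vanish. -/
lemma CrystSol.exists_velocity_eq {I : Set ℝ} (S : CrystSol I) {W : ℝ → ℝ} {K m t : ℝ}
    (hW1 : ∀ y, HasDerivAt W (deriv W y) y)
    (hW2 : ∀ y, HasDerivAt (deriv W) (iteratedDeriv 2 W y) y)
    (h0 : S.s 0 = S.s 2) (hN1 : S.s (S.N + 1) = S.s (S.N - 1))
    (hK : ∀ i, 1 ≤ i → i ≤ S.N → |S.s i| ≤ K) (hm : 0 ≤ m)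
    (hsm : ∀ i, 1 ≤ i → i ≤ S.N + 1 → |S.s i - S.s (i - 1)| ≤ m)
    (hvb : S.v 1 t = 0 ∧ S.v S.N t = 0)
    (hv : ∀ i, 2 ≤ i → i ≤ S.N - 1 →
      S.v i t = Real.sqrt (1 + (S.s i) ^ 2) * secondDD W S.s i / S.len i t)
    {k : ℕ} (hk : k < S.N) :
    ∃ θ, |θ| ≤ K ∧ |θ - S.s (k + 1)| ≤ m ∧
      S.v (k + 1) t = Real.sqrt (1 + (S.s (k + 1)) ^ 2) * iteratedDeriv 2 W θ *
        (((S.s (k + 1) - S.s k) + (S.s (k + 2) - S.s (k + 1))) / 2) /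
        (S.x (k + 1) t - S.x k t) := by
  have hN := S.hN
  by_cases hk0 : k = 0
  · subst hk0
    exact ⟨S.s 1, hK 1 le_rfl hk, by simpa using hm, by simp [hvb.1, h0]⟩
  by_cases hkN : k + 1 = S.N
  · refine ⟨S.s (k + 1), hK (k + 1) (by omega) hk, by simpa using hm, ?_⟩
    have e : S.s (k + 2) = S.s k := by
      rw [← hkN] at hN1
      simpa using hN1
    rw [hkN, hvb.2, ← hkN, e]
    simp
  obtain ⟨θ, hθ, hθeq⟩ := exists_divided_difference_eq hW1 hW2
    (C := Icc (-K) K ∩ Icc (S.s (k + 1) - m) (S.s (k + 1) + m))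
    ((convex_Icc _ _).inter (convex_Icc _ _)) (y := S.s (k + 1)) (p := S.s k) (q := S.s (k + 2))
    ⟨abs_le.1 (hK (k + 1) (by omega) (by omega)), by constructor <;> linarith⟩
    ⟨abs_le.1 (hK k (by omega) (by omega)), by
      have := abs_le.1 (hsm (k + 1) (by omega) (by omega))
      rw [Nat.add_sub_cancel] at this
      constructor <;> linarith⟩
    ⟨abs_le.1 (hK (k + 2) (by omega) (by omega)), by
      have := abs_le.1 (hsm (k + 2) (by omega) (by omega))
      rw [show k + 2 - 1 = k + 1 by omega] at this
      constructor <;> linarith⟩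
    (S.hs k (by omega) (by omega)).symm (S.hs (k + 1) (by omega) (by omega)).symm
  refine ⟨θ, abs_le.2 hθ.1, abs_le.2 ⟨by linarith [hθ.2.1], by linarith [hθ.2.2]⟩, ?_⟩
  have hdd : secondDD W S.s (k + 1) = iteratedDeriv 2 W θ * ((S.s (k + 2) - S.s k) / 2) := hθeq
  rw [hv (k + 1) (by omega) (by omega), hdd, CrystSol.len, Nat.add_sub_cancel]
  ring

/-- Bounds on the data that do not depend on the discretization. -/
lemma exists_uniform_constants {W : ℝ → ℝ} (hw : ContDiff ℝ 1 (iteratedDeriv 2 W))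
    (hWpp : ∀ y : ℝ, 0 < iteratedDeriv 2 W y) {K T : ℝ} (hK : 0 < K) (H : C3Sol T) :
    ∃ R a₀ L C F B : ℝ, K ≤ R ∧ 0 < a₀ ∧ 0 ≤ L ∧ 0 ≤ C ∧ 0 ≤ F ∧ 0 ≤ B ∧
      (∀ ξ ∈ Icc (0 : ℝ) 1, ∀ t ∈ Icc 0 T,
        |H.ux ξ t| ≤ R ∧ |H.uxx ξ t| ≤ F ∧ |H.uxt ξ t| ≤ B) ∧
      (∀ y, |y| ≤ R → a₀ ≤ iteratedDeriv 2 W y) ∧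
      (∀ y z, |y| ≤ R → |z| ≤ R →
        |Real.sqrt (1 + y ^ 2) * iteratedDeriv 2 W y -
          Real.sqrt (1 + z ^ 2) * iteratedDeriv 2 W z| ≤ L * |y - z|) ∧
      (∀ y z, |y| ≤ R → |z| ≤ R →
        |Real.sqrt (1 + y ^ 2) * (iteratedDeriv 2 W y - iteratedDeriv 2 W z)| ≤ C * |y - z|) := by
  have hcomp : IsCompact (Icc (0 : ℝ) 1 ×ˢ Icc 0 T) := isCompact_Icc.prod isCompact_Icc
  obtain ⟨R₁, hR₁⟩ := hcomp.exists_bound_of_continuousOn H.hcont_ux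
  obtain ⟨F, hF⟩ := hcomp.exists_bound_of_continuousOn H.hcont_uxx
  obtain ⟨B, hB⟩ := hcomp.exists_bound_of_continuousOn H.hcont_uxt
  set R := max K R₁
  have hKR : K ≤ R := le_max_left _ _
  have hR0 : 0 ≤ R := hK.le.trans hKR
  have hA : ContDiff ℝ 1 (fun y => Real.sqrt (1 + y ^ 2) * iteratedDeriv 2 W y) :=
    ((contDiff_const.add (contDiff_id.pow 2)).sqrt fun y => by positivity).mul hw
  obtain ⟨L, hL⟩ := hA.contDiffOn.exists_lipschitzOnWith one_ne_zero (convex_Icc (-R) R)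
    isCompact_Icc
  obtain ⟨C, hC⟩ := hw.contDiffOn.exists_lipschitzOnWith one_ne_zero (convex_Icc (-R) R)
    isCompact_Icc
  obtain ⟨y₀, -, hy₀⟩ := (isCompact_Icc (a := -R) (b := R)).exists_isMinOn
    ⟨0, by constructor <;> linarith⟩ hw.continuous.continuousOn
  refine ⟨R, iteratedDeriv 2 W y₀, L, (1 + R) * C, max F 0, max B 0, hKR, hWpp y₀, L.2,
    mul_nonneg (by linarith) C.2, le_max_right _ _, le_max_right _ _, ?_, ?_, ?_, ?_⟩
  · intro ξ hξ t ht
    exact ⟨(hR₁ (ξ, t) ⟨hξ, ht⟩).trans (le_max_right _ _),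
      (hF (ξ, t) ⟨hξ, ht⟩).trans (le_max_left _ _), (hB (ξ, t) ⟨hξ, ht⟩).trans (le_max_left _ _)⟩
  · exact fun y hy => hy₀ (abs_le.1 hy)
  · exact fun y z hy hz => hL.dist_le_mul y (abs_le.1 hy) z (abs_le.1 hz)
  · intro y z hy hz
    rw [abs_mul, abs_of_nonneg (Real.sqrt_nonneg _), mul_assoc]
    have h1 : Real.sqrt (1 + y ^ 2) ≤ 1 + R := by
      rw [Real.sqrt_le_left (by linarith)]
      nlinarith [sq_abs y, abs_nonneg y]
    exact mul_le_mul h1 (hC.dist_le_mul y (abs_le.1 hy) z (abs_le.1 hz)) (abs_nonneg _)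
      (by linarith)


/-- Differential inequality for the crystalline approximation of motion of a graph by
weighted curvature (homogeneous Dirichlet boundary conditions): for small `m`, the squared
`L²` error of the slopes `Υ(t) = (1/2)∫₀¹ |u_x - u_x^m|²` satisfies
`Υ' ≤ Λ(t) Υ + Γ(t) m`, with `Λ, Γ` continuous, nonnegative and independent of the
discretization. -/
theorem weighted_curvature_differential_inequality (W : ℝ → ℝ) (hW : ContDiff ℝ 3 W)
    (hWpp : ∀ y : ℝ, 0 < iteratedDeriv 2 W y)
    (K T : ℝ) (hK : 0 < K) (hT : 0 < T) (H : C3Sol T)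
    (hpde : ∀ ξ ∈ Set.Icc (0:ℝ) 1, ∀ t ∈ Set.Icc (0:ℝ) T,
      H.ut ξ t = Real.sqrt (1 + (H.ux ξ t) ^ 2) * iteratedDeriv 2 W (H.ux ξ t) * H.uxx ξ t)
    (hbc : ∀ t ∈ Set.Icc (0:ℝ) T, H.u 0 t = 0 ∧ H.u 1 t = 0) :
    ∃ m₀ : ℝ, 0 < m₀ ∧ ∃ Λ Γ : ℝ → ℝ,
      ContinuousOn Λ (Set.Icc 0 T) ∧ ContinuousOn Γ (Set.Icc 0 T) ∧
      (∀ t ∈ Set.Icc (0:ℝ) T, 0 ≤ Λ t ∧ 0 ≤ Γ t) ∧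
      ∀ m : ℝ, 0 < m → m ≤ m₀ →
      ∀ I : Set ℝ, I ⊆ Set.Icc 0 T → ∀ S : CrystSol I, ∀ uxm : ℝ → ℝ → ℝ,
      SlopeLink S uxm →
      S.s 0 = S.s 2 → S.s (S.N + 1) = S.s (S.N - 1) →
      (∀ i, 1 ≤ i → i ≤ S.N → |S.s i| ≤ K) →
      (∀ i, 1 ≤ i → i ≤ S.N + 1 → |S.s i - S.s (i - 1)| ≤ m) →
      (∀ i, 2 ≤ i → i ≤ S.N - 1 → S.s (i - 1) ≠ S.s (i + 1) →
        S.s i ∈ Set.Ioo (min (S.s (i - 1)) (S.s (i + 1)))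
          (max (S.s (i - 1)) (S.s (i + 1)))) →
      (∀ t ∈ I, S.v 1 t = 0 ∧ S.v S.N t = 0) →
      (∀ t ∈ I, ∀ i, 2 ≤ i → i ≤ S.N - 1 →
        S.v i t = Real.sqrt (1 + (S.s i) ^ 2) * secondDD W S.s i / S.len i t) →
      ∀ t ∈ I, ∃ d : ℝ,
        HasDerivWithinAt
          (fun σ => (1 / 2) * ∫ ξ in (0:ℝ)..1, (H.ux ξ σ - uxm ξ σ) ^ 2) d I t ∧
        d ≤ Λ t * ((1 / 2) * ∫ ξ in (0:ℝ)..1, (H.ux ξ t - uxm ξ t) ^ 2) + Γ t * m := by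
  have hw : ContDiff ℝ 1 (iteratedDeriv 2 W) := by
    rw [iteratedDeriv_eq_iterate]
    exact ContDiff.iterate_deriv' 1 2 (by exact_mod_cast hW)
  have hW1 : ∀ y, HasDerivAt W (deriv W y) y := fun y =>
    (hW.differentiable (by norm_num) y).hasDerivAt
  have hW2 : ∀ y, HasDerivAt (deriv W) (iteratedDeriv 2 W y) y := by
    intro y
    rw [iteratedDeriv_succ, iteratedDeriv_one]
    have hd := hW.differentiable_iteratedDeriv 1 (by norm_num)
    rw [iteratedDeriv_one] at hd
    exact (hd y).hasDerivAt
  obtain ⟨R, a₀, L, C, F, B, hKR, ha₀, hL, hC, hF, hB, hbound, hwlow, hAlip, hwlip⟩ :=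
    exists_uniform_constants hw hWpp hK H
  refine ⟨1, one_pos, fun _ => F ^ 2 * L ^ 2 / a₀, fun _ => B + F ^ 2 * C ^ 2 / (2 * a₀),
    continuousOn_const, continuousOn_const, fun t _ => ⟨by positivity, by positivity⟩, ?_⟩
  intro m hm hm1 I hI S uxm hlink hs0 hsN hsK hsm _ hvb hv t ht
  have hN := S.hN
  have htT := hI ht
  let v' : ℕ → ℝ := fun k => if 1 ≤ k ∧ k ≤ S.N then S.v k t else 0
  let c : ℕ → ℝ := fun k =>
    if 1 ≤ k ∧ k + 1 ≤ S.N then -((S.v (k + 1) t - S.v k t) / (S.s (k + 1) - S.s k)) else 0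
  have hc : ∀ k ≤ S.N, HasDerivWithinAt (S.x k) (c k) I t := by
    intro k hk
    by_cases h : 1 ≤ k ∧ k + 1 ≤ S.N
    · simp only [c, if_pos h]
      exact S.hcorner t ht k h.1 h.2
    · simp only [c, if_neg h]
      obtain rfl | rfl : k = 0 ∨ k = S.N := by omega
      · exact (hasDerivWithinAt_const t I (0 : ℝ)).congr S.hx0 (S.hx0 t ht)
      · exact (hasDerivWithinAt_const t I (1 : ℝ)).congr S.hxN (S.hxN t ht)
  have hv'1 : v' 1 = 0 := by simp [v', (hvb t ht).1]
  have hv'N : v' S.N = 0 := by simp [v', (hvb t ht).2]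
  have hv'0 : v' 0 = 0 := by simp [v']
  have hv'N1 : v' (S.N + 1) = 0 := by simp [v']
  have hcv : ∀ k ≤ S.N, c k * (S.s (k + 1) - S.s k) = -(v' (k + 1) - v' k) := by
    intro k hk
    by_cases h : 1 ≤ k ∧ k + 1 ≤ S.N
    · have hne := sub_ne_zero.2 (S.hs k h.1 h.2).symm
      simp only [c, v', if_pos h, if_pos (show 1 ≤ k ∧ k ≤ S.N by omega),
        if_pos (show 1 ≤ k + 1 ∧ k + 1 ≤ S.N by omega)]
      rw [neg_mul, div_mul_cancel₀ _ hne]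
    · obtain rfl | rfl : k = 0 ∨ k = S.N := by omega
      · simp [c, hv'0, hv'1]
      · simp [c, hv'N, hv'N1]
  have hut0 : H.ut 0 t = 0 := H.ut_eq_zero hT (by simp) (fun σ hσ => (hbc σ hσ).1) htT
  have hut1 : H.ut 1 t = 0 := H.ut_eq_zero hT (by simp) (fun σ hσ => (hbc σ hσ).2) htT
  refine ⟨_, S.hasDerivWithinAt_slopeError H hI hlink ht hc, ?_⟩
  have cx := C3Sol.continuousOn_slice H.hcont_ux htT
  have cxx := C3Sol.continuousOn_slice H.hcont_uxx htT
  have ct := C3Sol.continuousOn_slice H.hcont_ut htT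
  rw [sum_corner_terms_eq (N := S.N) (s := S.s) (c := c) (U := fun k => H.ux (S.x k t) t)
      (g := fun k => H.ut (S.x k t) t) (v := v') (by simp [c]) (by simp [c])
      (by simpa [S.hx0 t ht] using hut0) (by simpa [S.hxN t ht] using hut1)
      (by simp [hv'0, hv'1]) (by simp [hv'N, hv'N1]) hcv,
    H.integral_ux_mul_uxt hT htT hut0 hut1,
    S.integral_eq_sum_of_continuousOn ht (h := fun ξ => H.uxx ξ t * H.ut ξ t) (cxx.mul ct),
    ← Finset.sum_neg_distrib, ← Finset.sum_add_distrib]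
  have hrhs : F ^ 2 * L ^ 2 / a₀ * (1 / 2 * ∫ ξ in (0 : ℝ)..1, (H.ux ξ t - uxm ξ t) ^ 2) +
      (B + F ^ 2 * C ^ 2 / (2 * a₀)) * m =
      ∑ k ∈ Finset.range S.N, ∫ ξ in (S.x k t)..(S.x (k + 1) t),
        (F ^ 2 * L ^ 2 / (2 * a₀) * (H.ux ξ t - S.s (k + 1)) ^ 2 +
          (B + F ^ 2 * C ^ 2 / (2 * a₀)) * m) := by
    have hlen : ∑ k ∈ Finset.range S.N, (S.x (k + 1) t - S.x k t) = 1 := by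
      rw [Finset.sum_range_sub (fun k => S.x k t), S.hxN t ht, S.hx0 t ht, sub_zero]
    have hface : ∀ k ∈ Finset.range S.N, ∫ ξ in (S.x k t)..(S.x (k + 1) t),
        (F ^ 2 * L ^ 2 / (2 * a₀) * (H.ux ξ t - S.s (k + 1)) ^ 2 +
          (B + F ^ 2 * C ^ 2 / (2 * a₀)) * m) =
        F ^ 2 * L ^ 2 / (2 * a₀) *
          (∫ ξ in (S.x k t)..(S.x (k + 1) t), (H.ux ξ t - S.s (k + 1)) ^ 2) +
          (S.x (k + 1) t - S.x k t) * ((B + F ^ 2 * C ^ 2 / (2 * a₀)) * m) := by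
      intro k hk
      have hk' := Finset.mem_range.1 hk
      have hi : IntervalIntegrable (fun ξ => (H.ux ξ t - S.s (k + 1)) ^ 2) volume (S.x k t)
          (S.x (k + 1) t) := ContinuousOn.intervalIntegrable_of_Icc (S.hmono t ht k hk').le
        (((cx.mono (S.face_subset ht hk')).sub continuousOn_const).pow 2)
      rw [intervalIntegral.integral_add (hi.const_mul _) intervalIntegrable_const,
        intervalIntegral.integral_const_mul, intervalIntegral.integral_const, smul_eq_mul]
    rw [Finset.sum_congr rfl hface, Finset.sum_add_distrib, ← Finset.mul_sum, ← Finset.sum_mul,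
      hlen, S.integral_sq_sub_slope hlink ht cx]
    field_simp
  rw [hrhs]
  refine Finset.sum_le_sum fun k hk => ?_
  have hk' := Finset.mem_range.1 hk
  have hlt := S.hmono t ht k hk'
  have hsub := S.face_subset ht hk'
  obtain ⟨θ, hθK, hθm, hθv⟩ := S.exists_velocity_eq hW1 hW2 hs0 hsN hsK hm.le hsm (hvb t ht)
    (hv t ht) hk'
  have hθR := hθK.trans hKR
  have hsR := (hsK (k + 1) (by omega) hk').trans hKR
  have hosc : ∀ p ∈ Icc (S.x k t) (S.x (k + 1) t), ∀ q ∈ Icc (S.x k t) (S.x (k + 1) t), p ≤ q →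
      |H.ut q t - H.ut p t| ≤ B * (S.x (k + 1) t - S.x k t) := by
    intro p hp q hq hpq
    rw [← H.integral_uxt hT (hsub hp).1 hpq (hsub hq).2 htT]
    refine (intervalIntegral.norm_integral_le_of_norm_le_const (a := p) (b := q)
      (f := fun ξ => H.uxt ξ t) (C := B) fun ξ hξ => ?_).trans ?_
    · rw [uIoc_of_le hpq] at hξ
      exact (hbound ξ ⟨(hsub hp).1.trans hξ.1.le, hξ.2.trans (hsub hq).2⟩ t htT).2.2
    · rw [abs_of_nonneg (sub_nonneg.2 hpq)]
      gcongr
      exacts [hq.2, hp.1]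
  have hinc := integral_eq_sub_of_hasDerivWithinAt_Icc hlt.le hsub (H.huxx t htT) cxx
  rw [← hinc]
  refine face_defect_le hlt (cx.mono hsub) (cxx.mono hsub) (ct.mono hsub)
    (fun ξ hξ => ?_) (fun ξ hξ => hosc ξ hξ _ (right_mem_Icc.2 hlt.le) hξ.2) hB
    (by simpa using hsm (k + 1) (by omega) (by omega))
    (by simpa using hsm (k + 2) (by omega) (by omega)) hm.le hm1 (fun ξ hξ => ?_) ha₀
    (A := Real.sqrt (1 + (S.s (k + 1)) ^ 2) * iteratedDeriv 2 W θ) ?_ ?_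
  · rw [abs_sub_comm]
    exact hosc _ (left_mem_Icc.2 hlt.le) ξ hξ hξ.1
  · obtain ⟨hpR, hfF, -⟩ := hbound ξ (hsub hξ) t htT
    rw [hpde ξ (hsub hξ) t htT, ← sub_mul, abs_mul]
    refine mul_le_mul ?_ hfF (abs_nonneg _) (by positivity)
    have h1 := hAlip _ _ hpR hsR
    have h2 := (hwlip _ _ hsR hθR).trans (mul_le_mul_of_nonneg_left
      ((abs_sub_comm _ _).trans_le hθm) hC)
    refine le_trans (le_trans (le_of_eq ?_) (abs_add_le _ _)) (add_le_add h1 h2)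
    congr 1
    ring
  · exact (hwlow θ hθR).trans (le_mul_of_one_le_left (hWpp θ).le
      (Real.one_le_sqrt.2 (by nlinarith [sq_nonneg (S.s (k + 1))])))
  · rw [← hθv]
    simp only [v', if_pos (show 1 ≤ k + 1 ∧ k + 1 ≤ S.N by omega)]
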